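/- (Fractional Sobolev inequality) Let p > 1 with ps < N. Then there exists a constant S > 0, depending only on N, s and p, such that for every v ∈ C_c^∞(ℝ^N): ∫∫_{ℝ^N×ℝ^N} |v(x)−v(y)|^p/|x−y|^{N+ps} dx dy ≥ S (∫_{ℝ^N} |v(x)|^{p*_s} dx)^{p/p*_s}, where p*_s = pN/(N−ps). -/

import Mathlib

open MeasureTheory

noncomputable section

abbrev Euc (N : ℕ) := EuclideanSpace ℝ (Fin N)

theorem add_rpow_le_two_rpow_mul {a b p : ℝ} (ha : 0 ≤ a) (hb : 0 ≤ b) (hp : 1 ≤ p) :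
    (a + b) ^ p ≤ 2 ^ (p - 1) * (a ^ p + b ^ p) := by
  lift a to NNReal using ha
  lift b to NNReal using hb
  exact_mod_cast NNReal.rpow_add_le_mul_rpow_add_rpow a b hp

theorem le_of_forall_scale_le {ω A b G I σ : ℝ} (hω : 0 < ω) (hA : 0 ≤ A) (hb : 0 ≤ b)
    (hG : 0 ≤ G) (hI : 0 < I) (hσ : σ < 1)
    (h : ∀ R : ℝ, 0 < R →
      ω * R * b ≤ A * (R ^ (1 + σ) * G + (ω * R) ^ σ * I ^ (1 - σ))) :
    b ^ (1 / (1 - σ)) ≤ (A * (1 + ω ^ σ) / ω) ^ (1 / (1 - σ)) * I ^ σ * G := by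
  have hθ : 0 < 1 - σ := by linarith
  have hc : 0 ≤ A * (1 + ω ^ σ) / ω := by positivity
  have key : ∀ H : ℝ, G < H →
      b ^ (1 / (1 - σ)) ≤ (A * (1 + ω ^ σ) / ω) ^ (1 / (1 - σ)) * I ^ σ * H := by
    intro H hGH
    have hH : 0 < H := hG.trans_lt hGH
    have hR : 0 < I ^ (1 - σ) / H := by positivity
    set R := I ^ (1 - σ) / H with hRdef
    have hJ : I ^ (1 - σ) = R * H := by rw [hRdef]; field_simp
    have h1 := h R hR
    rw [hJ, Real.mul_rpow hω.le hR.le, Real.rpow_add hR, Real.rpow_one] at h1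
    have h2 : ω * R * b ≤ R * (A * (1 + ω ^ σ) * (R ^ σ * H)) := by
      refine h1.trans ?_
      have : A * (R * R ^ σ * G) ≤ A * (R * R ^ σ * H) := by gcongr
      nlinarith
    have h3 : b ≤ A * (1 + ω ^ σ) / ω * (R ^ σ * H) := by
      rw [div_mul_eq_mul_div, le_div_iff₀ hω]
      have : R * (b * ω) ≤ R * (A * (1 + ω ^ σ) * (R ^ σ * H)) := by linarith
      exact le_of_mul_le_mul_left this hR
    have h4 : R ^ σ * H = (I ^ σ * H) ^ (1 - σ) := by
      rw [hRdef, Real.div_rpow (by positivity) hH.le, Real.mul_rpow (by positivity) hH.le,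
        Real.rpow_sub hH, Real.rpow_one, ← Real.rpow_mul hI.le, ← Real.rpow_mul hI.le,
        mul_comm σ]
      ring
    rw [h4] at h3
    calc b ^ (1 / (1 - σ))
        ≤ (A * (1 + ω ^ σ) / ω * (I ^ σ * H) ^ (1 - σ)) ^ (1 / (1 - σ)) := by gcongr
      _ = _ := by
        rw [Real.mul_rpow hc (by positivity), ← Real.rpow_mul (by positivity),
          mul_one_div_cancel hθ.ne', Real.rpow_one, mul_assoc]
  refine ge_of_tendsto (f := fun H => (A * (1 + ω ^ σ) / ω) ^ (1 / (1 - σ)) * I ^ σ * H)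
    (x := nhdsWithin G (Set.Ioi G)) ?_ (Filter.eventually_of_mem self_mem_nhdsWithin key)
  exact ((continuous_const.mul continuous_id).tendsto G).mono_left nhdsWithin_le_nhds

theorem integrable_min_rpow_div_norm_rpow {N : ℕ} (hN : 0 < N) {s p : ℝ} (hs : 0 < s)
    (hs1 : s < 1) (hp : 0 < p) {L M : ℝ} (hL : 0 ≤ L) (hM : 0 ≤ M) :
    Integrable (fun z : Euc N => min (L * ‖z‖) M ^ p / ‖z‖ ^ ((N : ℝ) + p * s)) := by
  have : Nonempty (Fin N) := ⟨⟨0, hN⟩⟩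
  have : Nontrivial (Euc N) := inferInstanceAs (Nontrivial (EuclideanSpace ℝ (Fin N)))
  refine (integrable_fun_norm_addHaar (volume : Measure (Euc N))
    (f := fun t : ℝ => min (L * t) M ^ p / t ^ ((N : ℝ) + p * s))).2 ?_
  rw [finrank_euclideanSpace_fin]
  have hmeas : Measurable
      fun t : ℝ => t ^ (N - 1) • (min (L * t) M ^ p / t ^ ((N : ℝ) + p * s)) := by
    simp only [smul_eq_mul]; fun_prop
  have hN1 : ((N - 1 : ℕ) : ℝ) = (N : ℝ) - 1 := by
    rw [Nat.cast_sub hN]; simp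
  have hps : 0 < p * s := by positivity
  have hps1 : 0 < p * (1 - s) := mul_pos hp (by linarith)
  have hmin : ∀ t : ℝ, 0 < t → 0 ≤ min (L * t) M := fun t ht => le_min (by positivity) hM
  rw [← Set.Ioc_union_Ioi_eq_Ioi zero_le_one]
  refine IntegrableOn.union ?_ ?_
  · have hint : IntegrableOn (fun t : ℝ => L ^ p * t ^ (p * (1 - s) - 1)) (Set.Ioc 0 1) := by
      rw [integrableOn_Ioc_iff_integrableOn_Ioo]
      exact ((intervalIntegral.integrableOn_Ioo_rpow_iff zero_lt_one).2
        (by linarith)).const_mul _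
    refine hint.mono' hmeas.aestronglyMeasurable ?_
    refine (ae_restrict_iff' measurableSet_Ioc).2 (.of_forall fun t ht => ?_)
    have ht0 : 0 < t := ht.1
    have := hmin t ht0
    rw [smul_eq_mul, Real.norm_of_nonneg (by positivity)]
    calc t ^ (N - 1) * (min (L * t) M ^ p / t ^ ((N : ℝ) + p * s))
        ≤ t ^ (N - 1) * ((L * t) ^ p / t ^ ((N : ℝ) + p * s)) := by
          gcongr; exact min_le_left _ _
      _ = L ^ p * t ^ (p * (1 - s) - 1) := by
        rw [Real.mul_rpow hL ht0.le, ← Real.rpow_natCast, hN1, mul_div_assoc,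
          ← Real.rpow_sub ht0, mul_left_comm, ← Real.rpow_add ht0]
        ring_nf
  · have hint : IntegrableOn (fun t : ℝ => M ^ p * t ^ (-(p * s) - 1)) (Set.Ioi 1) :=
      (integrableOn_Ioi_rpow_of_lt (by linarith) zero_lt_one).const_mul _
    refine hint.mono' hmeas.aestronglyMeasurable ?_
    refine (ae_restrict_iff' measurableSet_Ioi).2 (.of_forall fun t ht => ?_)
    have ht0 : 0 < t := zero_lt_one.trans ht
    have := hmin t ht0
    rw [smul_eq_mul, Real.norm_of_nonneg (by positivity)]
    calc t ^ (N - 1) * (min (L * t) M ^ p / t ^ ((N : ℝ) + p * s))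
        ≤ t ^ (N - 1) * (M ^ p / t ^ ((N : ℝ) + p * s)) := by
          gcongr; exact min_le_right _ _
      _ = M ^ p * t ^ (-(p * s) - 1) := by
        rw [← Real.rpow_natCast, hN1, mul_div_left_comm, ← Real.rpow_sub ht0]
        ring_nf

theorem integrable_gagliardo {N : ℕ} (hN : 0 < N) {s p : ℝ} (hs : 0 < s) (hs1 : s < 1)
    (hp : 0 < p) {v : Euc N → ℝ} (hv : ContDiff ℝ (⊤ : ℕ∞) v) (hc : HasCompactSupport v) :
    Integrable (fun z : Euc N × Euc N => |v z.1 - v z.2| ^ p / ‖z.1 - z.2‖ ^ ((N : ℝ) + p * s))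
      (volume.prod volume) := by
  obtain ⟨L, hL⟩ := hv.lipschitzWith_of_hasCompactSupport hc (by simp)
  obtain ⟨M, hM⟩ := hc.exists_bound_of_continuous hv.continuous
  have hM0 : 0 ≤ M := (norm_nonneg _).trans (hM 0)
  set φ : Euc N → ℝ := fun z => min (L * ‖z‖) (2 * M) ^ p / ‖z‖ ^ ((N : ℝ) + p * s) with hφ
  have hφi : Integrable φ :=
    integrable_min_rpow_div_norm_rpow hN hs hs1 hp L.coe_nonneg (by positivity)
  set χ : Euc N → ℝ := (tsupport v).indicator 1 with hχ
  have hχi : Integrable χ :=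
    (integrable_indicator_iff (isClosed_tsupport v).measurableSet).2
      (integrableOn_const hc.isCompact.measure_lt_top.ne)
  have h1 : Integrable (fun z : Euc N × Euc N => χ z.2 * φ (z.1 - z.2)) (volume.prod volume) :=
    hχi.convolution_integrand (ContinuousLinearMap.mul ℝ ℝ) hφi
  have hφs : ∀ x y, φ (x - y) = φ (y - x) := fun x y => by simp only [hφ, norm_sub_rev]
  have h2 : Integrable (fun z : Euc N × Euc N => χ z.1 * φ (z.1 - z.2))
      (volume.prod volume) := by
    refine h1.swap.congr (.of_forall fun z => ?_)
    simp [Prod.swap, hφs z.2 z.1]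
  refine (h1.add h2).mono' ?_ (.of_forall fun z => ?_)
  · have := hv.continuous.measurable
    exact Measurable.aestronglyMeasurable (by fun_prop)
  · obtain ⟨x, y⟩ := z
    have hχ0 : ∀ x, 0 ≤ χ x := fun x => Set.indicator_nonneg (fun _ _ => zero_le_one) x
    have hmin : |v x - v y| ≤ min (L * ‖x - y‖) (2 * M) := by
      refine le_min ?_ ?_
      · simpa [dist_eq_norm] using hL.dist_le_mul x y
      · have := abs_sub (v x) (v y)
        have h1 := hM x
        have h2 := hM y
        rw [Real.norm_eq_abs] at h1 h2
        linarith
    have hle : |v x - v y| ^ p / ‖x - y‖ ^ ((N : ℝ) + p * s) ≤ φ (x - y) := by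
      simp only [hφ]; gcongr
    have hφ0 : 0 ≤ φ (x - y) := le_trans (by positivity) hle
    rw [Real.norm_of_nonneg (by positivity)]
    simp only [Pi.add_apply]
    by_cases hx : x ∈ tsupport v
    · have : χ x = 1 := by simp [hχ, hx]
      rw [this]
      nlinarith [mul_nonneg (hχ0 y) hφ0]
    by_cases hy : y ∈ tsupport v
    · have : χ y = 1 := by simp [hχ, hy]
      rw [this]
      nlinarith [mul_nonneg (hχ0 x) hφ0]
    · rw [image_eq_zero_of_notMem_tsupport hx, image_eq_zero_of_notMem_tsupport hy]
      have := mul_nonneg (hχ0 y) hφ0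
      have := mul_nonneg (hχ0 x) hφ0
      simp only [sub_self, abs_zero, Real.zero_rpow hp.ne', zero_div]
      positivity

theorem setIntegral_rpow_le {α : Type*} [MeasurableSpace α] [TopologicalSpace α]
    [OpensMeasurableSpace α] {μ : Measure α} [IsFiniteMeasureOnCompacts μ] {v : α → ℝ}
    (hv : Continuous v) (hc : HasCompactSupport v) {B : Set α} (hB : μ B ≠ ⊤) {p σ : ℝ}
    (hp : 0 < p) (hσ : 0 < σ) (hσ1 : σ < 1) :
    ∫ y in B, |v y| ^ p ∂μ ≤ μ.real B ^ σ * (∫ y, |v y| ^ (p / (1 - σ)) ∂μ) ^ (1 - σ) := by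
  have hθ : 0 < 1 - σ := by linarith
  have hconj : (1 / (1 - σ)).HolderConjugate (1 / σ) := by
    rw [Real.holderConjugate_iff]
    refine ⟨by rw [lt_div_iff₀ hθ]; linarith, by simp⟩
  have hcont : ∀ r : ℝ, 0 < r → Continuous fun y => |v y| ^ r := fun r hr =>
    hv.abs.rpow_const fun _ => Or.inr hr.le
  have hcs : ∀ r : ℝ, 0 < r → HasCompactSupport fun y => |v y| ^ r := fun r hr =>
    hc.comp_left (g := fun t : ℝ => |t| ^ r) (by simp [hr.ne'])
  have : IsFiniteMeasure (μ.restrict B) := ⟨by simpa using hB.lt_top⟩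
  have h := integral_mul_le_Lp_mul_Lq_of_nonneg (μ := μ.restrict B) hconj
    (f := fun y => |v y| ^ p) (g := fun _ => 1) (.of_forall fun _ => by positivity)
    (.of_forall fun _ => zero_le_one)
    (((hcont p hp).memLp_of_hasCompactSupport (hcs p hp)).restrict B) (memLp_const _)
  simp only [mul_one, Real.one_rpow, one_div_one_div, integral_const, smul_eq_mul,
    measureReal_restrict_apply_univ, ← Real.rpow_mul (abs_nonneg _), mul_one_div] at h
  refine h.trans ?_
  rw [mul_comm]
  have hq : 0 < p / (1 - σ) := by positivity
  gcongr
  · exact .of_forall fun _ => by positivity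
  · exact (hcont _ hq).integrable_of_hasCompactSupport (hcs _ hq)
  · exact Measure.restrict_le_self

theorem ball_scale_bound {N : ℕ} (hN : 0 < N) {s p : ℝ} (hs : 0 < s)
    (hp : 1 < p) (hps : p * s < N) {v : Euc N → ℝ} (hv : Continuous v)
    (hc : HasCompactSupport v) {x : Euc N}
    (hx : Integrable fun y => |v x - v y| ^ p / ‖x - y‖ ^ ((N : ℝ) + p * s))
    {R : ℝ} (hR : 0 < R) :
    volume.real (Metric.ball (0 : Euc N) 1) * R * |v x| ^ p ≤
      2 ^ (p - 1) * (R ^ (1 + p * s / N) * (∫ y, |v x - v y| ^ p / ‖x - y‖ ^ ((N : ℝ) + p * s)) +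
        (volume.real (Metric.ball (0 : Euc N) 1) * R) ^ (p * s / N) *
          (∫ y, |v y| ^ (p / (1 - p * s / N))) ^ (1 - p * s / N)) := by
  have hN' : (0 : ℝ) < N := by exact_mod_cast hN
  have hp0 : 0 < p := by linarith
  set r : ℝ := R ^ (1 / (N : ℝ)) with hr
  have hr0 : 0 < r := by positivity
  set B := Metric.ball x r
  have hvol : volume.real B = volume.real (Metric.ball (0 : Euc N) 1) * R := by
    rw [Measure.real, Measure.addHaar_ball_of_pos _ _ hr0, ENNReal.toReal_mul,
      ENNReal.toReal_ofReal (by positivity), finrank_euclideanSpace_fin, hr, ← Real.rpow_natCast,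
      ← Real.rpow_mul hR.le, one_div_mul_cancel hN'.ne', Real.rpow_one, mul_comm, Measure.real]
  have hrR : r ^ ((N : ℝ) + p * s) = R ^ (1 + p * s / N) := by
    rw [hr, ← Real.rpow_mul hR.le]
    congr 1
    field_simp
  have hB : volume B ≠ ⊤ := measure_ball_lt_top.ne
  have hvp : Integrable fun y => |v y| ^ p :=
    (hv.abs.rpow_const fun _ => Or.inr hp0.le).integrable_of_hasCompactSupport
      (hc.comp_left (g := fun t : ℝ => |t| ^ p) (by simp [hp0.ne']))
  have hσ : p * s / N < 1 := by rw [div_lt_one hN']; exact hps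
  rw [← hvol, ← hrR]
  set F : Euc N → ℝ := fun y => |v x - v y| ^ p / ‖x - y‖ ^ ((N : ℝ) + p * s) with hF
  have hF0 : ∀ y, 0 ≤ F y := fun y => by positivity
  calc volume.real B * |v x| ^ p = ∫ _ in B, |v x| ^ p := by
        rw [setIntegral_const, smul_eq_mul]
    _ ≤ ∫ y in B, 2 ^ (p - 1) * (r ^ ((N : ℝ) + p * s) * F y + |v y| ^ p) := by
        refine setIntegral_mono_on (integrableOn_const hB)
          (((hx.const_mul _).add hvp).const_mul _).integrableOn measurableSet_ball
          fun y hy => ?_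
        have h1 : |v x| ^ p ≤ 2 ^ (p - 1) * (|v x - v y| ^ p + |v y| ^ p) := by
          refine le_trans ?_ (add_rpow_le_two_rpow_mul (abs_nonneg _) (abs_nonneg _) hp.le)
          gcongr
          simpa using abs_add_le (v x - v y) (v y)
        refine h1.trans ?_
        gcongr
        rcases eq_or_ne x y with rfl | hxy
        · simp [Real.zero_rpow hp0.ne']
          positivity
        · have hn : 0 < ‖x - y‖ := norm_pos_iff.2 (sub_ne_zero.2 hxy)
          have hlt : ‖x - y‖ ≤ r := by
            rw [← dist_eq_norm, dist_comm]; exact (Metric.mem_ball.1 hy).le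
          simp only [hF]
          rw [mul_div_assoc', le_div_iff₀ (by positivity), mul_comm]
          gcongr
    _ = 2 ^ (p - 1) * (r ^ ((N : ℝ) + p * s) * (∫ y in B, F y) + ∫ y in B, |v y| ^ p) := by
        rw [integral_const_mul, integral_add (hx.const_mul _).integrableOn hvp.integrableOn,
          integral_const_mul]
    _ ≤ _ := by
        gcongr ?_ * (?_ * ?_ + ?_)
        · exact setIntegral_le_integral hx (.of_forall hF0)
        · exact setIntegral_rpow_le hv hc hB hp0 (by positivity) hσ

theorem stmt_13
    (N : ℕ) (hN : 0 < N) (s : ℝ) (hs : s ∈ Set.Ioo (0 : ℝ) 1)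
    (p : ℝ) (hp : 1 < p) (hps : p * s < N) :
    ∃ S : ℝ, 0 < S ∧
      ∀ v : Euc N → ℝ, ContDiff ℝ (⊤ : ℕ∞) v → HasCompactSupport v →
        S * (∫ x, |v x| ^ (p * N / ((N : ℝ) - p * s))) ^ (p / (p * N / ((N : ℝ) - p * s))) ≤
          ∫ x, ∫ y, |v x - v y| ^ p / ‖x - y‖ ^ ((N : ℝ) + p * s) := by
  obtain ⟨hs0, hs1⟩ := hs
  have hN' : (0 : ℝ) < N := by exact_mod_cast hN
  have hp0 : 0 < p := by linarith
  have hD : 0 < (N : ℝ) - p * s := by linarith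
  have hσ : p * s / N < 1 := by rw [div_lt_one hN']; exact hps
  have hq : p * N / ((N : ℝ) - p * s) = p / (1 - p * s / N) := by
    field_simp
  have hθ : p / (p / (1 - p * s / N)) = 1 - p * s / N := by
    field_simp
  rw [hq, hθ]
  set σ := p * s / N with hσdef
  have hθ0 : 0 < 1 - σ := by linarith
  set ω := volume.real (Metric.ball (0 : Euc N) 1) with hωdef
  have hω : 0 < ω := ENNReal.toReal_pos (Metric.measure_ball_pos _ _ one_pos).ne'
    measure_ball_lt_top.ne
  set C := ((2 : ℝ) ^ (p - 1) * (1 + ω ^ σ) / ω) ^ (1 / (1 - σ)) with hC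
  have hC0 : 0 < C := by positivity
  refine ⟨C⁻¹, inv_pos.2 hC0, fun v hv hc => ?_⟩
  have hint := integrable_gagliardo hN hs0 hs1 hp0 hv hc
  set G : Euc N → ℝ := fun x => ∫ y, |v x - v y| ^ p / ‖x - y‖ ^ ((N : ℝ) + p * s) with hG
  have hG0 : ∀ x, 0 ≤ G x := fun x => integral_nonneg fun y => by positivity
  have hGi : Integrable G := hint.integral_prod_left
  set I := ∫ x, |v x| ^ (p / (1 - σ)) with hI
  have hI0 : 0 ≤ I := integral_nonneg fun x => by positivity
  rcases hI0.eq_or_lt with h0 | hIpos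
  · rw [← h0, Real.zero_rpow hθ0.ne', mul_zero]
    exact integral_nonneg hG0
  have hle : I ≤ C * I ^ σ * ∫ x, G x := by
    rw [← integral_const_mul]
    have hq0 : 0 < p / (1 - σ) := by positivity
    refine integral_mono_ae
      ((hv.continuous.abs.rpow_const fun _ => Or.inr hq0.le).integrable_of_hasCompactSupport
        (hc.comp_left (g := fun t : ℝ => |t| ^ (p / (1 - σ))) (by simp [hq0.ne'])))
      (hGi.const_mul _) ?_
    filter_upwards [hint.prod_right_ae] with x hx
    have := le_of_forall_scale_le hω (by positivity) (by positivity) (hG0 x) hIpos hσ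
      fun R hR => ball_scale_bound hN hs0 hp hps hv.continuous hc hx hR
    rwa [← Real.rpow_mul (abs_nonneg _), mul_one_div] at this
  rw [inv_mul_le_iff₀ hC0, Real.rpow_sub hIpos, Real.rpow_one, div_le_iff₀ (by positivity)]
  linarith

end
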